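/- arXiv:1112.1183 — 2 statements merged into one kernel-verified Lean document; each statement's English description precedes it below -/
import Mathlib

section
/- Let β, β' > 1, let a_1 a_2 ⋯ be the (−β)-expansion of −β/(β+1) and a'_1 a'_2 ⋯ the (−β')-expansion of −β'/(β'+1), and suppose a_1 a_2 ⋯ <_alt a'_1 a'_2 ⋯. Then every sequence b_1 b_2 ⋯ that is the (−β)-expansion of some x ∈ [−β/(β+1), 1/(β+1)) is also the (−β')-expansion of some y ∈ [−β'/(β'+1), 1/(β'+1)). In particular, L_{β,n} ≤ L_{β',n} for all n ≥ 1. -/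
open Filter Set

/-- The (−β)-transformation on [−β/(β+1), 1/(β+1)). -/
noncomputable def negBetaT (β : ℝ) (x : ℝ) : ℝ := -β * x - ⌊β / (β + 1) - β * x⌋

/-- The digits of the (−β)-expansion of x; `negBetaDigit β x n` is ε_{n+1}(x). -/
noncomputable def negBetaDigit (β : ℝ) (x : ℝ) (n : ℕ) : ℤ :=
  ⌊β / (β + 1) - β * ((negBetaT β)^[n] x)⌋

/-- The (−β)-expansion of the left endpoint −β/(β+1); index n represents a_{n+1}. -/
noncomputable def negBetaExp (β : ℝ) (n : ℕ) : ℤ := negBetaDigit β (-β / (β + 1)) n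

/-- `b` is the (−β)-expansion of `x`. -/
def IsNegBetaExpOf (β : ℝ) (x : ℝ) (b : ℕ → ℤ) : Prop :=
  x ∈ Set.Ico (-β / (β + 1)) (1 / (β + 1)) ∧ ∀ n, b n = negBetaDigit β x n

/-- Alternating lexicographic strict order (0-based indexing: index k corresponds
to position k+1, so `Even k` means odd position). -/
def AltLt (x y : ℕ → ℤ) : Prop :=
  ∃ k, (∀ i, i < k → x i = y i) ∧ (if Even k then x k < y k else y k < x k)

/-- Alternating lexicographic order. -/
def AltLe (x y : ℕ → ℤ) : Prop := AltLt x y ∨ x = y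

def phiW : ℕ → List ℕ
  | 1 => [1, 0, 0]
  | _ => [1]

/-- `uWord n` is φ^n(1), where φ(1) = 100, φ(0) = 1. -/
def uWord : ℕ → List ℕ
  | 0 => [1]
  | n + 1 => (uWord n).flatMap phiW

/-- The sequence u = 100111001001001110011⋯ starting with φ^n(1) for all n. -/
def uSeq (n : ℕ) : ℤ := ((uWord (n + 1)).getD n 0 : ℕ)

/-- Condition (G): every shifted sequence is ≤_alt the sequence itself. -/
def CondG (a : ℕ → ℤ) : Prop := ∀ k, 1 ≤ k → AltLe (fun n => a (n + k)) a

/-- Condition (L): a >_alt u. -/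
def CondL (a : ℕ → ℤ) : Prop := AltLt uSeq a

/-- The periodic sequence (w)^∞. -/
def perSeq (w : List ℤ) : ℕ → ℤ := fun n => w.getD (n % w.length) 0

/-- `a` is an infinite concatenation of blocks from `S`. -/
def IsInfConcat (S : Set (List ℤ)) (a : ℕ → ℤ) : Prop :=
  ∃ w : ℕ → List ℤ, (∀ n, w n ∈ S) ∧
    ∀ N i, i < (((List.range N).map w).flatten).length →
      (((List.range N).map w).flatten).getD i 0 = a i

/-- Condition (A1). -/
def CondA1 (a : ℕ → ℤ) : Prop :=
  ∀ k, 1 ≤ k → AltLt uSeq (perSeq ((List.range k).map a)) →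
    IsInfConcat {(List.range k).map a, (List.range (k - 1)).map a ++ [a (k - 1) - 1, 0]} a →
    a = perSeq ((List.range k).map a)

/-- Condition (A2). -/
def CondA2 (a : ℕ → ℤ) : Prop :=
  ∀ k, 1 ≤ k → AltLt uSeq (perSeq ((List.range (k - 1)).map a ++ [a (k - 1) + 1])) →
    ¬ IsInfConcat {(List.range k).map a ++ [0], (List.range (k - 1)).map a ++ [a (k - 1) + 1]} a

/-- The cylinder set I_{b_1⋯b_n}. -/
def cylinder (β : ℝ) (w : List ℤ) : Set ℝ :=
  {x | x ∈ Set.Ico (-β / (β + 1)) (1 / (β + 1)) ∧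
    ∀ i, i < w.length → negBetaDigit β x i = w.getD i 0}

/-- L_{β,n}: the number of words of length n with nonempty cylinder. -/
noncomputable def Lnum (β : ℝ) (n : ℕ) : ℕ :=
  Set.ncard {w : List ℤ | w.length = n ∧ (cylinder β w).Nonempty}

/-- L'_{β,n}: the number of words of length n whose cylinder is an interval of
positive length. -/
noncomputable def Lnum' (β : ℝ) (n : ℕ) : ℕ :=
  Set.ncard {w : List ℤ | w.length = n ∧
    ∃ c d : ℝ, c < d ∧ Set.Ioo c d ⊆ cylinder β w ∧ cylinder β w ⊆ Set.Icc c d}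

/-- P_n(x) = (−x)^n + Σ_{j=1}^n (a_j+1)(−x)^{n−j}. -/
noncomputable def Pn (a : ℕ → ℤ) (n : ℕ) (x : ℝ) : ℝ :=
  (-x) ^ n + ∑ j ∈ Finset.range n, ((a j : ℝ) + 1) * (-x) ^ (n - 1 - j)

/-- J_n = {x > 1 : P_j(x) ∈ [0,1] for all 1 ≤ j ≤ n}. -/
def Jn (a : ℕ → ℤ) (n : ℕ) : Set ℝ :=
  {x | 1 < x ∧ ∀ j, 1 ≤ j → j ≤ n → Pn a j x ∈ Set.Icc (0 : ℝ) 1}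

theorem AltLt.trans {x y z : ℕ → ℤ} (hxy : AltLt x y) (hyz : AltLt y z) : AltLt x z := by
  obtain ⟨k, hk, hk'⟩ := hxy
  obtain ⟨m, hm, hm'⟩ := hyz
  rcases lt_trichotomy k m with h | h | h
  · refine ⟨k, fun i hi => (hk i hi).trans (hm i (hi.trans h)), ?_⟩
    rwa [← hm k h]
  · subst h
    refine ⟨k, fun i hi => (hk i hi).trans (hm i hi), ?_⟩
    split_ifs at * <;> omega
  · refine ⟨m, fun i hi => (hk i (hi.trans h)).trans (hm i hi), ?_⟩
    rwa [hk m h]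

theorem AltLt.irrefl (x : ℕ → ℤ) : ¬ AltLt x x := by
  rintro ⟨k, -, hk⟩
  split_ifs at hk <;> omega

theorem altLt_or_altLt_of_ne {x y : ℕ → ℤ} (h : x ≠ y) : AltLt x y ∨ AltLt y x := by
  classical
  have hex : ∃ k, x k ≠ y k := Function.ne_iff.mp h
  have hmin : ∀ i, i < Nat.find hex → x i = y i := fun i hi => by
    simpa using Nat.find_min hex hi
  have hne := Nat.find_spec hex
  by_cases he : Even (Nat.find hex)
  · rcases lt_or_gt_of_ne hne with hl | hl
    · exact Or.inl ⟨_, hmin, by rwa [if_pos he]⟩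
    · exact Or.inr ⟨_, fun i hi => (hmin i hi).symm, by rwa [if_pos he]⟩
  · rcases lt_or_gt_of_ne hne with hl | hl
    · exact Or.inr ⟨_, fun i hi => (hmin i hi).symm, by rwa [if_neg he]⟩
    · exact Or.inl ⟨_, hmin, by rwa [if_neg he]⟩

/-- `y` is a sequence of remainders for the digit sequence `s` in base `-B`. -/
def IsNegBetaOrbit (B : ℝ) (s : ℕ → ℤ) (y : ℕ → ℝ) : Prop :=
  ∀ n, -B * y n = s n + y (n + 1)

theorem IsNegBetaOrbit.shift {B : ℝ} {s : ℕ → ℤ} {y : ℕ → ℝ} (h : IsNegBetaOrbit B s y) (n : ℕ) :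
    IsNegBetaOrbit B (fun i => s (n + i)) (fun i => y (n + i)) :=
  fun i => h (n + i)

theorem IsNegBetaOrbit.pow_mul_sub {B : ℝ} {s s' : ℕ → ℤ} {y y' : ℕ → ℝ}
    (h : IsNegBetaOrbit B s y) (h' : IsNegBetaOrbit B s' y') (k : ℕ)
    (hk : ∀ i, i < k → s i = s' i) : (-B) ^ k * (y 0 - y' 0) = y k - y' k := by
  induction k with
  | zero => simp
  | succ k ih =>
    have e := ih fun i hi => hk i (by omega)
    have h1 := h k
    have h2 := h' k
    rw [hk k (by omega)] at h1
    rw [pow_succ, mul_right_comm, e]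
    linarith

/-- The difference of the values of two alternately ordered digit sequences, computed
at the first index where they differ. -/
theorem IsNegBetaOrbit.exists_of_altLt {B : ℝ} {s s' : ℕ → ℤ} {y y' : ℕ → ℝ}
    (h : IsNegBetaOrbit B s y) (h' : IsNegBetaOrbit B s' y') (hlt : AltLt s s') :
    ∃ k, (∀ i, i < k → s i = s' i) ∧
      ((Even k ∧ s k + 1 ≤ s' k ∧
          B ^ (k + 1) * (y 0 - y' 0) = (s' k - s k) + (y' (k + 1) - y (k + 1))) ∨
        (¬ Even k ∧ s' k + 1 ≤ s k ∧
          B ^ (k + 1) * (y 0 - y' 0) = (s k - s' k) + (y (k + 1) - y' (k + 1)))) := by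
  obtain ⟨k, hk, hk'⟩ := hlt
  refine ⟨k, hk, ?_⟩
  have e := h.pow_mul_sub h' k hk
  have h1 := h k
  have h2 := h' k
  by_cases he : Even k
  · rw [if_pos he] at hk'
    rw [he.neg_pow] at e
    refine Or.inl ⟨he, by omega, ?_⟩
    rw [pow_succ, mul_right_comm, e]
    linarith
  · rw [if_neg he] at hk'
    rw [(Nat.not_even_iff_odd.mp he).neg_pow] at e
    refine Or.inr ⟨he, by omega, ?_⟩
    have e' : B ^ k * (y 0 - y' 0) = -(y k - y' k) := by linarith
    rw [pow_succ, mul_right_comm, e']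
    linarith

theorem IsNegBetaOrbit.le_of_altLt {B : ℝ} (hB : 0 < B) {s s' : ℕ → ℤ} {y y' : ℕ → ℝ}
    (h : IsNegBetaOrbit B s y) (h' : IsNegBetaOrbit B s' y') (hlt : AltLt s s')
    (hd : ∀ n, |y n - y' n| ≤ 1) : y' 0 ≤ y 0 := by
  obtain ⟨k, -, hk⟩ := h.exists_of_altLt h' hlt
  have hp : 0 < B ^ (k + 1) := pow_pos hB _
  have hd' := abs_le.mp (hd (k + 1))
  have : 0 ≤ B ^ (k + 1) * (y 0 - y' 0) := by
    rcases hk with ⟨-, hs, e⟩ | ⟨-, hs, e⟩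
    · have hs' : (s k : ℝ) + 1 ≤ s' k := by exact_mod_cast hs
      rw [e]; linarith
    · have hs' : (s' k : ℝ) + 1 ≤ s k := by exact_mod_cast hs
      rw [e]; linarith
  linarith [nonneg_of_mul_nonneg_right this hp]

theorem IsNegBetaOrbit.lt_of_altLt {B : ℝ} (hB : 0 < B) {s s' : ℕ → ℤ} {y y' : ℕ → ℝ}
    (h : IsNegBetaOrbit B s y) (h' : IsNegBetaOrbit B s' y') (hlt : AltLt s s')
    (hd : ∀ n, |y n - y' n| < 1) : y' 0 < y 0 := by
  obtain ⟨k, -, hk⟩ := h.exists_of_altLt h' hlt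
  have hp : 0 < B ^ (k + 1) := pow_pos hB _
  have hd' := abs_lt.mp (hd (k + 1))
  have : 0 < B ^ (k + 1) * (y 0 - y' 0) := by
    rcases hk with ⟨-, hs, e⟩ | ⟨-, hs, e⟩
    · have hs' : (s k : ℝ) + 1 ≤ s' k := by exact_mod_cast hs
      rw [e]; linarith
    · have hs' : (s' k : ℝ) + 1 ≤ s k := by exact_mod_cast hs
      rw [e]; linarith
  linarith [(mul_pos_iff_of_pos_left hp).mp this]

/-- Bounded digit sequences have bounded orbits. -/
theorem exists_isNegBetaOrbit {B : ℝ} (hB : 1 < B) {s : ℕ → ℤ} {M : ℝ}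
    (hs : ∀ n, |(s n : ℝ)| ≤ M) : ∃ y, IsNegBetaOrbit B s y ∧ ∃ C, ∀ n, |y n| ≤ C := by
  have hB0 : B ≠ 0 := by positivity
  have hgeo : Summable fun k : ℕ => M * B⁻¹ ^ (k + 1) :=
    ((summable_nat_add_iff 1).mpr (summable_geometric_of_lt_one (by positivity)
      (inv_lt_one_of_one_lt₀ hB))).mul_left M
  have hle : ∀ n k : ℕ, ‖(s (n + k) : ℝ) * (-B)⁻¹ ^ (k + 1)‖ ≤ M * B⁻¹ ^ (k + 1) := by
    intro n k
    rw [norm_mul, norm_pow, norm_inv, norm_neg, Real.norm_eq_abs, Real.norm_of_nonneg (by positivity)]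
    exact mul_le_mul_of_nonneg_right (hs _) (by positivity)
  have hsum : ∀ n, Summable fun k : ℕ => (s (n + k) : ℝ) * (-B)⁻¹ ^ (k + 1) :=
    fun n => hgeo.of_norm_bounded (hle n)
  refine ⟨fun n => ∑' k : ℕ, (s (n + k) : ℝ) * (-B)⁻¹ ^ (k + 1), fun n => ?_,
    ∑' k : ℕ, M * B⁻¹ ^ (k + 1), fun n => ?_⟩
  · dsimp only
    rw [(hsum n).tsum_eq_zero_add, mul_add, ← tsum_mul_left]
    congr 1
    · simp only [add_zero, zero_add, pow_one]
      field_simp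
    · refine tsum_congr fun k => ?_
      rw [show n + (k + 1) = n + 1 + k by ring, pow_succ _ (k + 1)]
      field_simp
  · exact tsum_of_norm_bounded hgeo.hasSum (hle n)

theorem negBetaInterval_length {β : ℝ} (hβ : 1 < β) : 1 / (β + 1) = -β / (β + 1) + 1 := by
  have : β + 1 ≠ 0 := by positivity
  field_simp
  ring

theorem mul_negBetaInterval_right {β : ℝ} : β * (1 / (β + 1)) = -(-β / (β + 1)) := by
  ring

theorem left_mem_negBetaInterval {β : ℝ} (hβ : 1 < β) :
    -β / (β + 1) ∈ Set.Ico (-β / (β + 1)) (1 / (β + 1)) :=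
  ⟨le_rfl, by rw [negBetaInterval_length hβ]; linarith⟩

theorem negBetaT_mem {β : ℝ} (hβ : 1 < β) (x : ℝ) :
    negBetaT β x ∈ Set.Ico (-β / (β + 1)) (1 / (β + 1)) := by
  rw [negBetaInterval_length hβ, neg_div]
  unfold negBetaT
  have h1 := Int.floor_le (β / (β + 1) - β * x)
  have h2 := Int.lt_floor_add_one (β / (β + 1) - β * x)
  constructor <;> linarith

theorem iterate_negBetaT_mem {β : ℝ} (hβ : 1 < β) {x : ℝ}
    (hx : x ∈ Set.Ico (-β / (β + 1)) (1 / (β + 1))) (n : ℕ) :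
    (negBetaT β)^[n] x ∈ Set.Ico (-β / (β + 1)) (1 / (β + 1)) := by
  cases n with
  | zero => exact hx
  | succ n => rw [Function.iterate_succ_apply']; exact negBetaT_mem hβ _

theorem isNegBetaOrbit_iterate (β x : ℝ) :
    IsNegBetaOrbit β (negBetaDigit β x) (fun n => (negBetaT β)^[n] x) := by
  intro n
  simp only [Function.iterate_succ_apply', negBetaDigit]
  rw [negBetaT]
  ring

theorem negBetaDigit_add (β x : ℝ) (m n : ℕ) :
    negBetaDigit β x (m + n) = negBetaDigit β ((negBetaT β)^[m] x) n := by
  rw [negBetaDigit, negBetaDigit, add_comm m n, Function.iterate_add_apply]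

theorem negBetaDigit_mem_Icc {β : ℝ} (hβ : 1 < β) {x : ℝ}
    (hx : x ∈ Set.Ico (-β / (β + 1)) (1 / (β + 1))) (n : ℕ) :
    negBetaDigit β x n ∈ Set.Icc 0 ⌊β⌋ := by
  obtain ⟨h1, h2⟩ := iterate_negBetaT_mem hβ hx n
  have hpos : 0 < β := by linarith
  have h3 := mul_le_mul_of_nonneg_left h1 hpos.le
  have h4 := mul_le_mul_of_nonneg_left h2.le hpos.le
  have h5 : β * (-β / (β + 1)) = β / (β + 1) - β := by
    field_simp
    ring
  rw [mul_negBetaInterval_right, neg_div] at h4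
  exact ⟨Int.floor_nonneg.mpr (by linarith), Int.floor_le_floor (by linarith)⟩

theorem abs_iterate_negBetaT_sub_lt {β : ℝ} (hβ : 1 < β) {x y : ℝ}
    (hx : x ∈ Set.Ico (-β / (β + 1)) (1 / (β + 1)))
    (hy : y ∈ Set.Ico (-β / (β + 1)) (1 / (β + 1))) (n : ℕ) :
    |(negBetaT β)^[n] x - (negBetaT β)^[n] y| < 1 := by
  obtain ⟨h1, h2⟩ := iterate_negBetaT_mem hβ hx n
  obtain ⟨h3, h4⟩ := iterate_negBetaT_mem hβ hy n
  rw [negBetaInterval_length hβ] at h2 h4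
  rw [abs_lt]
  constructor <;> linarith

theorem negBetaDigit_injOn {β : ℝ} (hβ : 1 < β) :
    Set.InjOn (negBetaDigit β) (Set.Ico (-β / (β + 1)) (1 / (β + 1))) := by
  intro x hx y hy hxy
  by_contra hne
  have hpos : 0 < |x - y| := abs_pos.mpr (sub_ne_zero.mpr hne)
  obtain ⟨n, hn⟩ := pow_unbounded_of_one_lt (1 / |x - y|) hβ
  have e := (isNegBetaOrbit_iterate β x).pow_mul_sub (isNegBetaOrbit_iterate β y) n
    fun i _ => congrFun hxy i
  have hlt := abs_iterate_negBetaT_sub_lt hβ hx hy n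
  rw [← e, abs_mul, abs_pow, abs_neg, abs_of_pos (by linarith : 0 < β)] at hlt
  rw [div_lt_iff₀ hpos] at hn
  simp only [Function.iterate_zero, id_eq] at hlt
  linarith

theorem altLe_negBetaExp {β : ℝ} (hβ : 1 < β) {x : ℝ}
    (hx : x ∈ Set.Ico (-β / (β + 1)) (1 / (β + 1))) :
    AltLe (negBetaDigit β x) (negBetaExp β) := by
  by_cases h : negBetaDigit β x = negBetaExp β
  · exact Or.inr h
  · refine Or.inl ((altLt_or_altLt_of_ne h).resolve_right fun hlt => ?_)
    have hl := left_mem_negBetaInterval hβ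
    have := (isNegBetaOrbit_iterate β (-β / (β + 1))).lt_of_altLt (by linarith)
      (isNegBetaOrbit_iterate β x) hlt (abs_iterate_negBetaT_sub_lt hβ hl hx)
    exact absurd this (not_lt.mpr hx.1)

/-- Prepending a zero to the expansion of the left endpoint never gives an expansion. -/
theorem negBetaDigit_shift_ne {β : ℝ} (hβ : 1 < β) {x : ℝ}
    (hx : x ∈ Set.Ico (-β / (β + 1)) (1 / (β + 1))) {n : ℕ} (hn : negBetaDigit β x n = 0) :
    (fun i => negBetaDigit β x (n + 1 + i)) ≠ negBetaExp β := by
  intro h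
  have hs : (negBetaT β)^[n + 1] x = -β / (β + 1) :=
    negBetaDigit_injOn hβ (iterate_negBetaT_mem hβ hx _) (left_mem_negBetaInterval hβ) <| by
      funext i
      rw [← negBetaDigit_add]
      exact congrFun h i
  have e := isNegBetaOrbit_iterate β x n
  have hr := (iterate_negBetaT_mem hβ hx n).2
  have hr' := mul_lt_mul_of_pos_left hr (by linarith : 0 < β)
  simp only [hn, hs, Int.cast_zero] at e
  rw [mul_negBetaInterval_right] at hr'
  linarith

/-- Nonnegative digit sequences all of whose shifts lie strictly below the `(-B)`-expansion
of the left endpoint. -/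
structure IsSubNegBeta (B : ℝ) (s : ℕ → ℤ) : Prop where
  nonneg : ∀ n, 0 ≤ s n
  shift_lt : ∀ n, AltLt (fun i => s (n + i)) (negBetaExp B)

namespace IsSubNegBeta

variable {B : ℝ} {s s' : ℕ → ℤ} {y y' : ℕ → ℝ}

theorem shift (h : IsSubNegBeta B s) (n : ℕ) : IsSubNegBeta B (fun i => s (n + i)) :=
  ⟨fun i => h.nonneg _, fun i => by simpa only [add_assoc] using h.shift_lt (n + i)⟩

theorem le_head (h : IsSubNegBeta B s) (n : ℕ) : s n ≤ negBetaExp B 0 := by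
  obtain ⟨k, hk, hk'⟩ := h.shift_lt n
  rcases Nat.eq_zero_or_pos k with rfl | hpos
  · simpa using (show s n < negBetaExp B 0 by simpa using hk').le
  · simpa using (hk 0 hpos).le

theorem exists_orbit (hB : 1 < B) (h : IsSubNegBeta B s) :
    ∃ y, IsNegBetaOrbit B s y ∧ ∃ C, ∀ n, |y n| ≤ C :=
  exists_isNegBetaOrbit hB (M := negBetaExp B 0) fun n => by
    rw [abs_of_nonneg (by exact_mod_cast h.nonneg n)]
    exact_mod_cast h.le_head n

theorem orbit_bound_div (hB : 1 < B) (h : IsSubNegBeta B s) (hy : IsNegBetaOrbit B s y) {D : ℝ}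
    (hD : 0 ≤ D) (hyD : ∀ n, y n ∈ Set.Icc (-B / (B + 1) - D) (1 / (B + 1) + D)) (n : ℕ) :
    y n ∈ Set.Icc (-B / (B + 1) - D / B) (1 / (B + 1) + D / B) := by
  have hB0 : 0 < B := by linarith
  have hlen := negBetaInterval_length hB
  constructor
  · obtain ⟨k, -, hk⟩ := (hy.shift n).exists_of_altLt
      (isNegBetaOrbit_iterate B (-B / (B + 1))) (h.shift_lt n)
    have ht := iterate_negBetaT_mem hB (left_mem_negBetaInterval hB) (k + 1)
    have hyk := hyD (n + (k + 1))
    have key : -D ≤ B ^ (k + 1) * (y n - -B / (B + 1)) := by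
      rcases hk with ⟨-, hs, e⟩ | ⟨-, hs, e⟩
      · have hs' : (s (n + k) : ℝ) + 1 ≤ negBetaDigit B (-B / (B + 1)) k := by exact_mod_cast hs
        simp only [add_zero, Function.iterate_zero, id_eq] at e
        rw [e]
        linarith [ht.1, hyk.2]
      · have hs' : (negBetaDigit B (-B / (B + 1)) k : ℝ) + 1 ≤ s (n + k) := by exact_mod_cast hs
        simp only [add_zero, Function.iterate_zero, id_eq] at e
        rw [e]
        linarith [ht.2, hyk.1]
    have hpow : B ≤ B ^ (k + 1) := le_self_pow₀ hB.le (by omega)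
    by_contra hcon
    have hneg : y n - -B / (B + 1) < -(D / B) := by linarith
    have h0 : 0 ≤ D / B := by positivity
    have h1 : B ^ (k + 1) * (y n - -B / (B + 1)) ≤ B * (y n - -B / (B + 1)) :=
      mul_le_mul_of_nonpos_right hpow (by linarith)
    have h2 : B * (y n - -B / (B + 1)) < B * -(D / B) := mul_lt_mul_of_pos_left hneg hB0
    have h3 : B * -(D / B) = -D := by field_simp
    linarith
  · have e := hy n
    have hs : (0 : ℝ) ≤ s n := by exact_mod_cast h.nonneg n
    have h1 : B * y n ≤ B * (1 / (B + 1) + D / B) := by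
      have h3 : B * (D / B) = D := by field_simp
      rw [mul_add, mul_negBetaInterval_right, h3]
      linarith [(hyD (n + 1)).1]
    exact le_of_mul_le_mul_left h1 hB0

theorem orbit_mem_Icc (hB : 1 < B) (h : IsSubNegBeta B s) (hy : IsNegBetaOrbit B s y) {C : ℝ}
    (hC : ∀ n, |y n| ≤ C) (n : ℕ) : y n ∈ Set.Icc (-B / (B + 1)) (1 / (B + 1)) := by
  have hB0 : 0 < B := by linarith
  have hC0 : 0 ≤ C := (abs_nonneg _).trans (hC 0)
  have hl : -B / (B + 1) ≤ 0 := div_nonpos_of_nonpos_of_nonneg (by linarith) (by linarith)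
  have hr : 0 ≤ 1 / (B + 1) := by positivity
  have hall : ∀ m n : ℕ, y n ∈ Set.Icc (-B / (B + 1) - C / B ^ m) (1 / (B + 1) + C / B ^ m) := by
    intro m
    induction m with
    | zero =>
      intro n
      have := abs_le.mp (hC n)
      simp only [pow_zero, div_one]
      constructor <;> linarith
    | succ m ih =>
      intro n
      have := h.orbit_bound_div hB hy (by positivity) ih n
      rwa [div_div, ← pow_succ] at this
  have hlim : Tendsto (fun m : ℕ => C / B ^ m) atTop (nhds 0) :=
    tendsto_const_nhds.div_atTop (tendsto_pow_atTop_atTop_of_one_lt hB)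
  constructor
  · refine le_of_tendsto' (f := fun m : ℕ => -B / (B + 1) - C / B ^ m) (x := atTop) ?_
      fun m => (hall m n).1
    simpa using tendsto_const_nhds.sub hlim
  · refine ge_of_tendsto' (f := fun m : ℕ => 1 / (B + 1) + C / B ^ m) (x := atTop) ?_
      fun m => (hall m n).2
    simpa using tendsto_const_nhds.add hlim

theorem of_eq_right (h : IsSubNegBeta B s) (hy : IsNegBetaOrbit B s y)
    (hmem : ∀ n, y n ∈ Set.Icc (-B / (B + 1)) (1 / (B + 1))) {n : ℕ} (hn : y n = 1 / (B + 1)) :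
    s n = 0 ∧ y (n + 1) = -B / (B + 1) := by
  have e := hy n
  rw [hn, neg_mul, mul_negBetaInterval_right, neg_neg] at e
  have h1 := (hmem (n + 1)).1
  have hs := h.nonneg n
  have hs' : (s n : ℝ) ≤ 0 := by linarith
  have hs0 : s n = 0 := le_antisymm (by exact_mod_cast hs') hs
  refine ⟨hs0, ?_⟩
  rw [hs0, Int.cast_zero] at e
  linarith

/-- A sequence representing the left endpoint starts with an odd period of the expansion of that
endpoint, its last digit being decreased by one, followed by zero. -/
theorem exists_of_eq_left (hB : 1 < B) (h : IsSubNegBeta B s) (hy : IsNegBetaOrbit B s y)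
    (hmem : ∀ n, y n ∈ Set.Icc (-B / (B + 1)) (1 / (B + 1))) (h0 : y 0 = -B / (B + 1)) :
    ∃ k, Even k ∧ (∀ i, i < k → s i = negBetaExp B i) ∧ s k = negBetaExp B k - 1 ∧
      (negBetaT B)^[k + 1] (-B / (B + 1)) = -B / (B + 1) ∧ s (k + 1) = 0 ∧
      y (k + 2) = -B / (B + 1) := by
  have hlen := negBetaInterval_length hB
  have hlt : AltLt s (negBetaExp B) := by simpa using h.shift_lt 0
  obtain ⟨k, hk, hk'⟩ := hy.exists_of_altLt (isNegBetaOrbit_iterate B (-B / (B + 1))) hlt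
  have ht := iterate_negBetaT_mem hB (left_mem_negBetaInterval hB) (k + 1)
  have hyk := hmem (k + 1)
  simp only [h0, Function.iterate_zero, id_eq, sub_self, mul_zero] at hk'
  rcases hk' with ⟨he, hs, e⟩ | ⟨-, hs, e⟩
  · have hs' : (s k : ℝ) + 1 ≤ negBetaDigit B (-B / (B + 1)) k := by exact_mod_cast hs
    have hsk' : (negBetaDigit B (-B / (B + 1)) k : ℝ) ≤ s k + 1 := by linarith [ht.1, hyk.2]
    have hsk : negBetaDigit B (-B / (B + 1)) k ≤ s k + 1 := by exact_mod_cast hsk'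
    have hr : y (k + 1) = 1 / (B + 1) := by linarith [ht.1, hyk.2]
    have hz := h.of_eq_right hy hmem hr
    refine ⟨k, he, hk, ?_, by linarith [ht.1, hyk.2], hz.1, hz.2⟩
    rw [negBetaExp]
    omega
  · have hs' : (negBetaDigit B (-B / (B + 1)) k : ℝ) + 1 ≤ s k := by exact_mod_cast hs
    linarith [ht.2, hyk.1]

theorem not_agree_of_odd_period (h : IsSubNegBeta B s) {k : ℕ} (hk : Even k)
    (ht : (negBetaT B)^[k + 1] (-B / (B + 1)) = -B / (B + 1))
    (hs : ∀ i, i < k + 1 → s i = negBetaExp B i) : False := by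
  have hper : ∀ j, negBetaExp B (k + 1 + j) = negBetaExp B j := fun j => by
    rw [negBetaExp, negBetaDigit_add, ht, negBetaExp]
  obtain ⟨j, hj, hj'⟩ := h.shift_lt (k + 1)
  have hgt : AltLt (negBetaExp B) s := by
    refine ⟨k + 1 + j, fun i hi => ?_, ?_⟩
    · by_cases hik : i < k + 1
      · exact (hs i hik).symm
      · obtain ⟨m, rfl⟩ := Nat.exists_eq_add_of_le (not_lt.mp hik)
        rw [hper]
        exact (hj m (by omega)).symm
    · have hpar : Even (k + 1 + j) ↔ ¬ Even j := by
        rw [Nat.even_add, Nat.even_add_one]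
        tauto
      rw [hper]
      by_cases he : Even j
      · rw [if_pos he] at hj'
        rwa [if_neg (by tauto)]
      · rw [if_neg he] at hj'
        rwa [if_pos (by tauto)]
  have hlt : AltLt s (negBetaExp B) := by simpa using h.shift_lt 0
  exact AltLt.irrefl _ (hgt.trans hlt)

theorem eq_of_eq_left (hB : 1 < B) (h : IsSubNegBeta B s) (hy : IsNegBetaOrbit B s y)
    (hmem : ∀ n, y n ∈ Set.Icc (-B / (B + 1)) (1 / (B + 1))) (h0 : y 0 = -B / (B + 1))
    (h' : IsSubNegBeta B s') (hy' : IsNegBetaOrbit B s' y')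
    (hmem' : ∀ n, y' n ∈ Set.Icc (-B / (B + 1)) (1 / (B + 1))) (h0' : y' 0 = -B / (B + 1)) :
    s = s' := by
  funext i
  induction i using Nat.strong_induction_on generalizing s s' y y' with
  | _ i ih =>
    obtain ⟨k, hke, hk, hsk, htk, hz, hyk⟩ := h.exists_of_eq_left hB hy hmem h0
    obtain ⟨m, hme, hm, hsm, htm, hz', hym⟩ := h'.exists_of_eq_left hB hy' hmem' h0'
    have hkm : k = m := by
      rcases lt_trichotomy k m with hlt | heq | hlt
      · exact (h'.not_agree_of_odd_period hke htk fun i hi => hm i (by omega)).elim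
      · exact heq
      · exact (h.not_agree_of_odd_period hme htm fun i hi => hk i (by omega)).elim
    subst hkm
    by_cases hik : i < k + 2
    · rcases (by omega : i < k ∨ i = k ∨ i = k + 1) with hi | rfl | rfl
      · rw [hk i hi, hm i hi]
      · rw [hsk, hsm]
      · rw [hz, hz']
    · obtain ⟨j, rfl⟩ := Nat.exists_eq_add_of_le (not_lt.mp hik)
      exact ih j (by omega) (h.shift (k + 2)) (hy.shift (k + 2)) (fun n => hmem _) hyk
        (h'.shift (k + 2)) (hy'.shift (k + 2)) (fun n => hmem' _) hym

end IsSubNegBeta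

theorem isSubNegBeta_negBetaDigit {β B : ℝ} (hβ : 1 < β)
    (hlt : AltLt (negBetaExp β) (negBetaExp B)) {x : ℝ}
    (hx : x ∈ Set.Ico (-β / (β + 1)) (1 / (β + 1))) : IsSubNegBeta B (negBetaDigit β x) := by
  refine ⟨fun n => (negBetaDigit_mem_Icc hβ hx n).1, fun n => ?_⟩
  simp only [negBetaDigit_add]
  rcases altLe_negBetaExp hβ (iterate_negBetaT_mem hβ hx n) with h | h
  · exact h.trans hlt
  · exact (show AltLt (negBetaDigit β ((negBetaT β)^[n] x)) _ from h ▸ hlt)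

theorem isNegBetaExpOf_of_orbit {B : ℝ} (hB : 1 < B) {s : ℕ → ℤ} {y : ℕ → ℝ}
    (hy : IsNegBetaOrbit B s y) (hmem : ∀ n, y n ∈ Set.Ico (-B / (B + 1)) (1 / (B + 1))) :
    IsNegBetaExpOf B (y 0) s := by
  have hfloor : ∀ n, ⌊B / (B + 1) - B * y n⌋ = s n := by
    intro n
    have e := hy n
    have hm := hmem (n + 1)
    rw [negBetaInterval_length hB, neg_div] at hm
    rw [Int.floor_eq_iff]
    constructor <;> linarith [hm.1, hm.2]
  have hit : ∀ n, (negBetaT B)^[n] (y 0) = y n := by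
    intro n
    induction n with
    | zero => rfl
    | succ n ih =>
      rw [Function.iterate_succ_apply', ih, negBetaT, hfloor]
      linarith [hy n]
  refine ⟨hmem 0, fun n => ?_⟩
  rw [negBetaDigit, hit, hfloor]

theorem exists_isNegBetaExpOf_of_altLt {β B : ℝ} (hβ : 1 < β) (hB : 1 < B)
    (hlt : AltLt (negBetaExp β) (negBetaExp B)) {x : ℝ}
    (hx : x ∈ Set.Ico (-β / (β + 1)) (1 / (β + 1))) :
    ∃ y, IsNegBetaExpOf B y (negBetaDigit β x) := by
  have hs := isSubNegBeta_negBetaDigit hβ hlt hx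
  have ha : IsSubNegBeta B (negBetaExp β) :=
    isSubNegBeta_negBetaDigit hβ hlt (left_mem_negBetaInterval hβ)
  obtain ⟨y, hy, C, hC⟩ := hs.exists_orbit hB
  obtain ⟨v, hv, C', hC'⟩ := ha.exists_orbit hB
  have hymem := hs.orbit_mem_Icc hB hy hC
  have hvmem := ha.orbit_mem_Icc hB hv hC'
  refine ⟨y 0, isNegBetaExpOf_of_orbit hB hy fun n =>
    ⟨(hymem n).1, lt_of_le_of_ne (hymem n).2 fun hn => ?_⟩⟩
  obtain ⟨hz, hl⟩ := hs.of_eq_right hy hymem hn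
  have hne := negBetaDigit_shift_ne hβ hx hz
  have hle := altLe_negBetaExp hβ (iterate_negBetaT_mem hβ hx (n + 1))
  have hfun : (fun i => negBetaDigit β x (n + 1 + i)) =
      negBetaDigit β ((negBetaT β)^[n + 1] x) := funext fun i => negBetaDigit_add β x (n + 1) i
  rw [← hfun] at hle
  have hvl : v 0 ≤ y (n + 1) :=
    (hy.shift (n + 1)).le_of_altLt (by linarith) hv (hle.resolve_right hne) fun i => by
      have h1 := hymem (n + 1 + i)
      have h2 := hvmem i
      rw [negBetaInterval_length hB] at h1 h2
      rw [abs_le]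
      constructor <;> linarith [h1.1, h1.2, h2.1, h2.2]
  exact hne ((hs.shift (n + 1)).eq_of_eq_left hB (hy.shift (n + 1)) (fun i => hymem _) hl
    ha hv hvmem (le_antisymm (hvl.trans hl.le) (hvmem 0).1))

theorem finite_negBeta_words {β : ℝ} (hβ : 1 < β) (n : ℕ) :
    {w : List ℤ | w.length = n ∧ (cylinder β w).Nonempty}.Finite := by
  refine ((Set.Finite.pi' fun _ : Fin n => Set.finite_Icc (0 : ℤ) ⌊β⌋).image List.ofFn).subset ?_
  rintro w ⟨rfl, x, hx, hw⟩
  refine ⟨w.get, fun i => ?_, List.ofFn_get w⟩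
  have := negBetaDigit_mem_Icc hβ hx i
  rwa [hw i i.2, List.getD_eq_getElem _ _ i.2] at this

/-- if a <_alt a', then every (−β)-expansion of a point of I_β is
also the (−β')-expansion of a point of I_{β'}; in particular L_{β,n} ≤ L_{β',n}. -/
theorem stmt_11 (β β' : ℝ) (hβ : 1 < β) (hβ' : 1 < β') (a a' : ℕ → ℤ)
    (ha : ∀ n, a n = negBetaExp β n) (ha' : ∀ n, a' n = negBetaExp β' n)
    (hlt : AltLt a a') :
    (∀ b : ℕ → ℤ, (∃ x : ℝ, IsNegBetaExpOf β x b) → ∃ y : ℝ, IsNegBetaExpOf β' y b) ∧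
    ∀ n : ℕ, 1 ≤ n → Lnum β n ≤ Lnum β' n := by
  obtain rfl : a = negBetaExp β := funext ha
  obtain rfl : a' = negBetaExp β' := funext ha'
  refine ⟨?_, fun n _ => Set.ncard_le_ncard ?_ (finite_negBeta_words hβ' n)⟩
  · rintro b ⟨x, hx, hb⟩
    obtain rfl : b = negBetaDigit β x := funext hb
    exact exists_isNegBetaExpOf_of_altLt hβ hβ' hlt hx
  · rintro w ⟨hw, x, hx, hxw⟩
    obtain ⟨y, hy, hyx⟩ := exists_isNegBetaExpOf_of_altLt hβ hβ' hlt hx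
    exact ⟨hw, y, hy, fun i hi => (hyx i).symm.trans (hxw i hi)⟩
end

section
/- Let a_1 a_2 ⋯ be a sequence of non-negative integers satisfying (G) and (L), and let n ≥ 1. If β, β' ∈ J_n and P_n(β) = P_n(β') ∈ {0,1}, then β = β'. -/
open Filter Set

lemma Pn_zero (a : ℕ → ℤ) (x : ℝ) : Pn a 0 x = 1 := by simp [Pn]

lemma Pn_succ (a : ℕ → ℤ) (n : ℕ) (x : ℝ) :
    Pn a (n + 1) x = (a n : ℝ) + 1 - x * Pn a n x := by
  have h : ∀ j ∈ Finset.range n, ((a j : ℝ) + 1) * (-x) ^ (n + 1 - 1 - j) =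
      (-x) * (((a j : ℝ) + 1) * (-x) ^ (n - 1 - j)) := by
    intro j hj
    have hj' := Finset.mem_range.1 hj
    rw [show n + 1 - 1 - j = (n - 1 - j) + 1 by omega]
    ring
  simp only [Pn]
  rw [Finset.sum_range_succ, Finset.sum_congr rfl h, ← Finset.mul_sum]
  simp
  ring

lemma Pn_mem_Icc {a : ℕ → ℤ} {n : ℕ} {x : ℝ} (hx : x ∈ Jn a n) {j : ℕ} (hj : j ≤ n) :
    Pn a j x ∈ Icc (0 : ℝ) 1 := by
  rcases Nat.eq_zero_or_pos j with rfl | h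
  · simp [Pn_zero]
  · exact hx.2 j h hj

lemma Jn_anti {a : ℕ → ℤ} {m n : ℕ} (h : m ≤ n) : Jn a n ⊆ Jn a m :=
  fun _ hx => ⟨hx.1, fun j h1 h2 => hx.2 j h1 (h2.trans h)⟩

/-- Comparison of slopes: if a finite set of pairs of points is invariant under the pair of maps
`x ↦ d + 1 - β x`, `x' ↦ d + 1 - β' x'` with common digits `d`, and the second coordinate
determines the first one, then `β ≤ β'`. -/
lemma slope_le_of_invariant {β β' : ℝ} (hβ' : 1 < β') (R : Finset (ℝ × ℝ))
    (h0 : ((0 : ℝ), (0 : ℝ)) ∈ R) (h1 : ((1 : ℝ), (1 : ℝ)) ∈ R)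
    (hI' : ∀ x ∈ R, x.2 ∈ Icc (0 : ℝ) 1)
    (hR : ∀ x ∈ R, ∃ d : ℤ, ((d : ℝ) + 1 - β * x.1, (d : ℝ) + 1 - β' * x.2) ∈ R)
    (hdet : ∀ x ∈ R, ∀ y ∈ R, x.2 = y.2 → x.1 = y.1) : β ≤ β' := by
  obtain ⟨w, hw, hmax⟩ := Finset.exists_max_image
    ((R ×ˢ R).filter fun w => w.2.2 < w.1.2) (fun w => (w.1.1 - w.2.1) / (w.1.2 - w.2.2))
    ⟨((1, 1), (0, 0)), by simp [h0, h1]⟩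
  obtain ⟨x, y⟩ := w
  simp only [Finset.mem_filter, Finset.mem_product] at hw
  obtain ⟨⟨hx, hy⟩, hlt⟩ := hw
  set c := (x.1 - y.1) / (x.2 - y.2) with hc
  have hle : ∀ p ∈ R, ∀ q ∈ R, q.2 ≤ p.2 → p.1 - q.1 ≤ c * (p.2 - q.2) := by
    intro p hp q hq hpq
    rcases hpq.eq_or_lt with h | h
    · rw [hdet q hq p hp h, h]; simp
    · have := hmax (p, q) (by simp [hp, hq, h])
      simp only at this
      rwa [div_le_iff₀ (by linarith)] at this
  have hc1 : 1 ≤ c := by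
    have := hle _ h1 _ h0 (by norm_num)
    norm_num at this; exact this
  have hxy : x.1 - y.1 = c * (x.2 - y.2) := by
    rw [hc, div_mul_cancel₀]; linarith
  obtain ⟨d, hd⟩ := hR x hx
  obtain ⟨e, he⟩ := hR y hy
  have hd' := hI' _ hd
  have he' := hI' _ he
  simp only [mem_Icc] at hd' he'
  have hpos : 0 < β' * (x.2 - y.2) := mul_pos (by linarith) (by linarith)
  have key : β * (x.1 - y.1) ≤ c * (β' * (x.2 - y.2)) := by
    rcases lt_trichotomy d e with hde | hde | hde
    · have : (d : ℝ) + 1 ≤ e := by exact_mod_cast hde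
      nlinarith
    · subst hde
      have := hle _ he _ hd (by simp only; nlinarith)
      simp only at this
      nlinarith
    · have h2 : (e : ℝ) + 1 ≤ d := by exact_mod_cast hde
      have h3 := hle _ h1 _ hd (by simp only; linarith)
      have h4 := hle _ he _ h0 (by simp only; linarith)
      simp only at h3 h4
      nlinarith [mul_nonneg (sub_nonneg.2 hc1) (sub_nonneg.2 h2)]
  rw [hxy] at key
  have hcp : 0 < c * (x.2 - y.2) := mul_pos (by linarith) (by linarith)
  by_contra hcon
  push Not at hcon
  nlinarith [mul_pos hcp (sub_pos.2 hcon)]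

/-- If a finite set of points in `[0, 1]` with at most `k + 1` elements contains the endpoints and
is invariant under suitable branches of `x ↦ -γ x mod 1`, then `2 ≤ γ ^ k`. -/
lemma two_le_pow_of_invariant {γ : ℝ} (hγ : 1 < γ) {k : ℕ} (S : Finset ℝ) (hcard : S.card ≤ k + 1)
    (h0 : (0 : ℝ) ∈ S) (h1 : (1 : ℝ) ∈ S) (hI : ∀ x ∈ S, x ∈ Icc (0 : ℝ) 1)
    (hS : ∀ x ∈ S, ∃ d : ℤ, (d : ℝ) + 1 - γ * x ∈ S) : 2 ≤ γ ^ k := by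
  obtain ⟨w, hw, hmin⟩ := Finset.exists_min_image
    ((S ×ˢ S).filter fun w => w.2 < w.1) (fun w => w.1 - w.2) ⟨(1, 0), by simp [h0, h1]⟩
  set δ := w.1 - w.2 with hδ
  simp only [Finset.mem_filter, Finset.mem_product] at hw
  have hδpos : 0 < δ := by linarith [hw.2]
  have hmin' : ∀ x ∈ S, ∀ y ∈ S, y < x → δ ≤ x - y := fun x hx y hy h =>
    hmin (x, y) (by simp [hx, hy, h])
  have hδ1 : δ ≤ 1 := by simpa using hmin' 1 h1 0 h0 one_pos
  have step : ∀ x ∈ S, ∀ y ∈ S, y < x →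
      2 * δ ≤ γ * (x - y) ∨ ∃ x' ∈ S, ∃ y' ∈ S, x' - y' = γ * (x - y) := by
    intro x hx y hy hlt
    obtain ⟨d, hd⟩ := hS x hx
    obtain ⟨e, he⟩ := hS y hy
    have hd' := hI _ hd
    have he' := hI _ he
    have hpos : 0 < γ * (x - y) := mul_pos (by linarith) (by linarith)
    rcases lt_trichotomy d e with hde | hde | hde
    · have : (d : ℝ) + 1 ≤ e := by exact_mod_cast hde
      nlinarith [hd'.1, he'.2]
    · subst hde
      exact Or.inr ⟨_, he, _, hd, by ring⟩
    · have h2 : (e : ℝ) + 1 ≤ d := by exact_mod_cast hde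
      have hsum : γ * (x - y) = (d - e - 1 : ℝ) + (1 - (d + 1 - γ * x)) + (e + 1 - γ * y) := by
        ring
      rcases hd'.2.eq_or_lt with h3 | h3 <;> rcases he'.1.eq_or_lt with h4 | h4
      · rcases (Int.add_one_le_iff.2 hde).eq_or_lt with h5 | h5
        · have : (e : ℝ) + 1 = d := by exact_mod_cast h5
          linarith
        · rcases (Int.add_one_le_iff.2 h5).eq_or_lt with h6 | h6
          · have : (e : ℝ) + 1 + 1 = d := by exact_mod_cast h6
            exact Or.inr ⟨1, h1, 0, h0, by linarith⟩
          · have : (e : ℝ) + 1 + 1 + 1 ≤ d := by exact_mod_cast h6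
            exact Or.inl (by linarith)
      · rcases (Int.add_one_le_iff.2 hde).eq_or_lt with h5 | h5
        · have : (e : ℝ) + 1 = d := by exact_mod_cast h5
          exact Or.inr ⟨_, he, 0, h0, by linarith⟩
        · have : (e : ℝ) + 1 + 1 ≤ d := by exact_mod_cast h5
          have := hmin' _ he _ h0 h4
          exact Or.inl (by linarith)
      · rcases (Int.add_one_le_iff.2 hde).eq_or_lt with h5 | h5
        · have : (e : ℝ) + 1 = d := by exact_mod_cast h5
          exact Or.inr ⟨1, h1, _, hd, by linarith⟩
        · have : (e : ℝ) + 1 + 1 ≤ d := by exact_mod_cast h5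
          have := hmin' _ h1 _ hd h3
          exact Or.inl (by linarith)
      · have := hmin' _ he _ h0 h4
        have := hmin' _ h1 _ hd h3
        exact Or.inl (by linarith)
  by_contra hcon
  push Not at hcon
  have hpow : ∀ m, m ≤ k → γ ^ m * δ < 2 * δ := fun m hm =>
    mul_lt_mul_of_pos_right ((pow_le_pow_right₀ hγ.le hm).trans_lt hcon) hδpos
  have hpair : ∀ m, m ≤ k → ∃ x ∈ S, ∃ y ∈ S, x - y = γ ^ m * δ := by
    intro m
    induction m with
    | zero => exact fun _ => ⟨w.1, hw.1.1, w.2, hw.1.2, by simp [hδ]⟩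
    | succ m ih =>
      intro hm
      obtain ⟨x, hx, y, hy, hxy⟩ := ih (by omega)
      have hp : 0 < γ ^ m * δ := by positivity
      have heq : γ * (x - y) = γ ^ (m + 1) * δ := by rw [hxy]; ring
      rcases step x hx y hy (by linarith) with h | ⟨x', hx', y', hy', h⟩
      · exact absurd (hpow (m + 1) hm) (by rw [← heq]; linarith)
      · exact ⟨x', hx', y', hy', h.trans heq⟩
  choose! X hX Y hY hXY using hpair
  have hgap : ∀ m, 0 < γ ^ m * δ := fun m => by positivity
  have hmaps : ∀ m ∈ Finset.range (k + 1), Y m ∈ S.erase 1 := by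
    intro m hm
    have hm' : m ≤ k := Nat.lt_succ_iff.1 (Finset.mem_range.1 hm)
    refine Finset.mem_erase.2 ⟨?_, hY m hm'⟩
    have := (hI _ (hX m hm')).2
    have := hXY m hm'
    have := hgap m
    exact ne_of_lt (by linarith)
  have hlt : (S.erase 1).card < (Finset.range (k + 1)).card := by
    rw [Finset.card_erase_of_mem h1, Finset.card_range]; omega
  obtain ⟨m, hm, l, hl, hne, heq⟩ := Finset.exists_ne_map_eq_of_card_lt_of_maps_to hlt hmaps
  have hm' : m ≤ k := Nat.lt_succ_iff.1 (Finset.mem_range.1 hm)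
  have hl' : l ≤ k := Nat.lt_succ_iff.1 (Finset.mem_range.1 hl)
  have aux : ∀ m l, m ≤ k → l ≤ k → Y m = Y l → ¬ m < l := by
    intro m l hm hl hY' hml
    have h1 : γ ^ m * δ < γ ^ l * δ :=
      mul_lt_mul_of_pos_right (pow_lt_pow_right₀ hγ hml) hδpos
    have h2 := hXY m hm
    have h3 := hXY l hl
    have h4 := hmin' _ (hX l hl) _ (hX m hm) (by linarith)
    have h5 := hmin' _ (hX m hm) _ (hY m hm) (by linarith [hgap m])
    linarith [hpow l hl]
  rcases lt_or_gt_of_ne hne with h | h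
  · exact aux m l hm' hl' heq h
  · exact aux l m hl' hm' heq.symm h

lemma two_le_pow_of_Pn {a : ℕ → ℤ} {k : ℕ} {γ : ℝ} (hγ : γ ∈ Jn a k) (hk : 1 ≤ k)
    (hval : Pn a k γ ∈ ({0, 1} : Set ℝ)) : 2 ≤ γ ^ k := by
  have hmem : ∀ i < k, Pn a i γ ∈ insert 0 ((Finset.range k).image fun i => Pn a i γ) :=
    fun i hi => Finset.mem_insert_of_mem (Finset.mem_image_of_mem _ (Finset.mem_range.2 hi))
  have h1 : (1 : ℝ) ∈ insert 0 ((Finset.range k).image fun i => Pn a i γ) := by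
    rw [← Pn_zero a γ]; exact hmem 0 hk
  refine two_le_pow_of_invariant hγ.1 (insert 0 ((Finset.range k).image fun i => Pn a i γ))
    ?_ (Finset.mem_insert_self _ _) h1 ?_ ?_
  · refine (Finset.card_insert_le _ _).trans (Nat.succ_le_succ ?_)
    simpa using Finset.card_image_le (s := Finset.range k) (f := fun i => Pn a i γ)
  · intro x hx
    rcases Finset.mem_insert.1 hx with rfl | hx
    · simp
    · obtain ⟨i, hi, rfl⟩ := Finset.mem_image.1 hx
      exact Pn_mem_Icc hγ (Finset.mem_range.1 hi).le
  · intro x hx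
    rcases Finset.mem_insert.1 hx with rfl | hx
    · exact ⟨0, by simpa using h1⟩
    · obtain ⟨i, hi, rfl⟩ := Finset.mem_image.1 hx
      refine ⟨a i, ?_⟩
      rw [← Pn_succ]
      rcases (Nat.succ_le_of_lt (Finset.mem_range.1 hi)).eq_or_lt with h | h
      · rw [show i + 1 = k from h]
        rcases hval with h | h
        · rw [h]; exact Finset.mem_insert_self _ _
        · rw [h]; exact h1
      · exact hmem _ h

lemma eq_of_sub_eq_int_sub {x y : ℝ} (hx : x ∈ Icc (0 : ℝ) 1) (hy : y ∈ Icc (0 : ℝ) 1)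
    (hy' : y ∉ ({0, 1} : Set ℝ)) {d e : ℤ} (h : x - y = d - e) : d = e := by
  simp only [mem_insert_iff, mem_singleton_iff, not_or] at hy'
  have h0 : 0 < y := lt_of_le_of_ne hy.1 (Ne.symm hy'.1)
  have h1 : y < 1 := lt_of_le_of_ne hy.2 hy'.2
  have h2 : (d : ℝ) < e + 1 := by linarith [hx.2]
  have h3 : (e : ℝ) < d + 1 := by linarith [hx.1]
  have h2' : d < e + 1 := by exact_mod_cast h2
  have h3' : e < d + 1 := by exact_mod_cast h3
  omega

/-- If the orbit of `1` meets `{0, 1}` only at time `n`, then its first `n` points are distinct. -/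
lemma Pn_injOn {a : ℕ → ℤ} {n : ℕ} {γ : ℝ} (hγ : γ ∈ Jn a n)
    (hval : Pn a n γ ∈ ({0, 1} : Set ℝ))
    (hprim : ∀ m, 1 ≤ m → m < n → Pn a m γ ∉ ({0, 1} : Set ℝ)) {i j : ℕ} (hij : i < j)
    (hj : j < n) : Pn a i γ ≠ Pn a j γ := by
  intro h
  have hshift : ∀ r, j + r ≤ n → Pn a (i + r) γ = Pn a (j + r) γ := by
    intro r
    induction r with
    | zero => exact fun _ => h
    | succ r ih =>
      intro hr
      have ih' := ih (by omega)
      have h1 := Pn_succ a (i + r) γ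
      have h2 := Pn_succ a (j + r) γ
      have h3 : a (j + r) = a (i + r) :=
        eq_of_sub_eq_int_sub (Pn_mem_Icc hγ (j := j + r + 1) (by omega))
          (Pn_mem_Icc hγ (j := i + r + 1) (by omega)) (hprim _ (by omega) (by omega))
          (by rw [h1, h2, ih']; ring)
      rw [← add_assoc, ← add_assoc, h1, h2, ih', h3]
  have := hshift (n - j) (by omega)
  rw [show j + (n - j) = n by omega] at this
  exact hprim (i + (n - j)) (by omega) (by omega) (this ▸ hval)

lemma le_of_forall_Pn_notMem {a : ℕ → ℤ} {n : ℕ} (hn : 1 ≤ n) {β β' : ℝ} (hβ' : β' ∈ Jn a n)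
    (heq : Pn a n β = Pn a n β') (hval : Pn a n β' ∈ ({0, 1} : Set ℝ))
    (hprim : ∀ m, 1 ≤ m → m < n → Pn a m β' ∉ ({0, 1} : Set ℝ)) : β ≤ β' := by
  set R : Finset (ℝ × ℝ) :=
    insert (0, 0) ((Finset.range n).image fun i => (Pn a i β, Pn a i β')) with hR
  have hmem : ∀ i < n, (Pn a i β, Pn a i β') ∈ R := fun i hi =>
    Finset.mem_insert_of_mem (Finset.mem_image_of_mem (fun i => (Pn a i β, Pn a i β'))
      (Finset.mem_range.2 hi))
  have h0 : ((0 : ℝ), (0 : ℝ)) ∈ R := Finset.mem_insert_self _ _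
  have h1 : ((1 : ℝ), (1 : ℝ)) ∈ R := by
    have := hmem 0 hn
    rwa [Pn_zero, Pn_zero] at this
  have hcases : ∀ x ∈ R, x = (0, 0) ∨ ∃ i < n, x = (Pn a i β, Pn a i β') := by
    intro x hx
    rcases Finset.mem_insert.1 hx with h | h
    · exact Or.inl h
    · obtain ⟨i, hi, rfl⟩ := Finset.mem_image.1 h
      exact Or.inr ⟨i, Finset.mem_range.1 hi, rfl⟩
  have hne : ∀ i < n, Pn a i β' ≠ 0 := by
    intro i hi h
    rcases Nat.eq_zero_or_pos i with rfl | hi0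
    · rw [Pn_zero] at h; norm_num at h
    · exact hprim i hi0 hi (by simp [h])
  refine slope_le_of_invariant hβ'.1 R h0 h1 ?_ ?_ ?_
  · intro x hx
    rcases hcases x hx with rfl | ⟨i, hi, rfl⟩
    · simp
    · exact Pn_mem_Icc hβ' hi.le
  · intro x hx
    rcases hcases x hx with rfl | ⟨i, hi, rfl⟩
    · exact ⟨0, by simpa using h1⟩
    · refine ⟨a i, ?_⟩
      simp only
      rw [← Pn_succ, ← Pn_succ]
      rcases (Nat.succ_le_of_lt hi).eq_or_lt with h | h
      · rw [show i + 1 = n from h, heq]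
        rcases hval with h | h
        · rw [h]; exact h0
        · rw [h]; exact h1
      · exact hmem _ h
  · intro x hx y hy hxy
    rcases hcases x hx with rfl | ⟨i, hi, rfl⟩ <;> rcases hcases y hy with rfl | ⟨j, hj, rfl⟩
    · rfl
    · exact absurd hxy.symm (hne j hj)
    · exact absurd hxy (hne i hi)
    · rcases lt_trichotomy i j with h | rfl | h
      · exact absurd hxy (Pn_injOn hβ' hval hprim h hj)
      · rfl
      · exact absurd hxy.symm (Pn_injOn hβ' hval hprim h hi)

/-- If the orbit of `1` in base `γ` first meets `{0, 1}` at time `k` and `2 ≤ b ^ k`, then at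
every later visit the orbits in bases `b` and `γ` are at least as far apart as at time `k`. -/
lemma abs_sub_le_abs_sub_of_two_le_pow {a : ℕ → ℤ} (hpos : ∀ n, 0 ≤ a n) {n k : ℕ} (hk : 1 ≤ k)
    {γ b : ℝ} (hγ : γ ∈ Jn a n) (hb : b ∈ Jn a n) (hkn : k ≤ n)
    (hval : Pn a k γ ∈ ({0, 1} : Set ℝ))
    (hprim : ∀ m, 1 ≤ m → m < k → Pn a m γ ∉ ({0, 1} : Set ℝ)) (hpow : 2 ≤ b ^ k)
    (hn : Pn a n γ ∈ ({0, 1} : Set ℝ)) :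
    |Pn a k b - Pn a k γ| ≤ |Pn a n b - Pn a n γ| := by
  have hshift : ∀ m, Pn a m γ = 1 → ∀ j, j < k → m + j ≤ n → Pn a (m + j) γ = Pn a j γ ∧
      Pn a (m + j) b - Pn a j b = (-b) ^ j * (Pn a m b - 1) := by
    intro m hm j
    induction j with
    | zero => intro _ _; simp [Pn_zero, hm]
    | succ j ih =>
      intro hj hmj
      obtain ⟨ih1, ih2⟩ := ih (by omega) (by omega)
      have h1 := Pn_succ a (m + j) γ
      have h2 := Pn_succ a j γ
      have h3 : a (m + j) = a j :=
        eq_of_sub_eq_int_sub (Pn_mem_Icc hγ (j := m + j + 1) (by omega))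
          (Pn_mem_Icc hγ (j := j + 1) (by omega)) (hprim _ (by omega) (by omega))
          (by rw [h1, h2, ih1]; ring)
      rw [← add_assoc]
      refine ⟨by rw [h1, h2, ih1, h3], ?_⟩
      rw [Pn_succ, Pn_succ, h3, pow_succ]
      linear_combination (-b) * ih2
  have hreturn : ∀ m, Pn a m γ = 1 → m + k ≤ n →
      Pn a (m + k) γ ∈ ({0, 1} : Set ℝ) ∧
      Pn a (m + k) b - Pn a (m + k) γ = Pn a k b - Pn a k γ + (-b) ^ k * (Pn a m b - 1) := by
    intro m hm hmk
    obtain ⟨k, rfl⟩ : ∃ l, k = l + 1 := ⟨k - 1, by omega⟩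
    obtain ⟨h1, h2⟩ := hshift m hm k (by omega) (by omega)
    have h3 := Pn_succ a (m + k) γ
    have h4 := Pn_succ a k γ
    have h5 := Pn_succ a (m + k) b
    have h6 := Pn_succ a k b
    have hI := Pn_mem_Icc hγ (j := m + k + 1) (by omega)
    rw [← add_assoc]
    constructor
    · by_contra hcon
      have : a k = a (m + k) :=
        eq_of_sub_eq_int_sub (Pn_mem_Icc hγ hkn) hI hcon (by rw [h3, h4, h1]; ring)
      apply hcon
      rw [h3, h1, ← this, ← h4]
      exact hval
    · rw [h3, h4, h5, h6, h1, pow_succ]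
      linear_combination (-b) * h2
  have main : ∀ d m, m + d = n → Pn a m γ = 1 →
      (m = 0 ∨ |Pn a k b - Pn a k γ| ≤ |Pn a m b - Pn a m γ|) →
      (m = 0 → 1 ≤ d) → |Pn a k b - Pn a k γ| ≤ |Pn a n b - Pn a n γ| := by
    intro d
    induction d using Nat.strong_induction_on with
    | _ d ih =>
    intro m hmd hm hdist hd
    rcases Nat.eq_zero_or_pos d with rfl | hd0
    · rcases hdist with h | h
      · exact absurd (hd h) (by omega)
      · rwa [← hmd]
    rcases lt_or_ge d k with hdk | hdk
    · have := (hshift m hm d hdk hmd.le).1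
      rw [hmd] at this
      exact absurd (this ▸ hn) (hprim d hd0 hdk)
    obtain ⟨h1, h2⟩ := hreturn m hm (by omega)
    have hfar : |Pn a k b - Pn a k γ| ≤ |Pn a (m + k) b - Pn a (m + k) γ| := by
      rcases hdist with rfl | h
      · simp
      · have h3 : |(-b) ^ k * (Pn a m b - 1)| = b ^ k * |Pn a m b - Pn a m γ| := by
          rw [abs_mul, abs_pow, abs_neg, abs_of_pos (by linarith [hb.1]), hm]
        have h4 : 2 * |Pn a m b - Pn a m γ| ≤ b ^ k * |Pn a m b - Pn a m γ| :=
          mul_le_mul_of_nonneg_right hpow (abs_nonneg _)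
        have h5 := abs_sub_abs_le_abs_sub ((-b) ^ k * (Pn a m b - 1)) (-(Pn a k b - Pn a k γ))
        rw [abs_neg, sub_neg_eq_add, add_comm ((-b) ^ k * _), ← h2, h3] at h5
        linarith
    rcases h1 with h1 | h1
    · rcases hdk.eq_or_lt with h | h
      · rwa [show m + k = n by omega] at hfar
      · have h3 := Pn_succ a (m + k) γ
        have h4 := Pn_succ a (m + k) b
        have h5 := Pn_mem_Icc hγ (j := m + k + 1) (by omega)
        have h6 : a (m + k) = 0 := by
          refine le_antisymm ?_ (hpos _)
          rw [h3, h1] at h5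
          have : (a (m + k) : ℝ) ≤ 0 := by linarith [h5.2]
          exact_mod_cast this
        rw [h6, h1] at h3
        rw [h6] at h4
        refine ih (d - k - 1) (by omega) (m + k + 1) (by omega) (by rw [h3]; simp)
          (Or.inr (hfar.trans ?_)) (by omega)
        rw [h3, h4, h1, show ((0 : ℤ) : ℝ) + 1 - b * Pn a (m + k) b - (((0 : ℤ) : ℝ) + 1 - γ * 0)
          = -(b * (Pn a (m + k) b - 0)) by ring, abs_neg, abs_mul,
          abs_of_pos (by linarith [hb.1] : 0 < b)]
        exact le_mul_of_one_le_left (abs_nonneg _) hb.1.le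
    · exact ih (d - k) (by omega) (m + k) (by omega) h1 (Or.inr hfar) (by omega)
  exact main n 0 (by omega) (Pn_zero a γ) (Or.inl rfl) (by omega)

/-- The first visit `k` of the orbit in base `γ` is also a visit of the orbit in base `b`. -/
lemma Pn_eq_of_two_le_pow {a : ℕ → ℤ} (hpos : ∀ n, 0 ≤ a n) {n k : ℕ} (hk : 1 ≤ k)
    {γ b : ℝ} (hγ : γ ∈ Jn a n) (hb : b ∈ Jn a n) (hkn : k ≤ n)
    (hval : Pn a k γ ∈ ({0, 1} : Set ℝ))
    (hprim : ∀ m, 1 ≤ m → m < k → Pn a m γ ∉ ({0, 1} : Set ℝ)) (hpow : 2 ≤ b ^ k)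
    (hn : Pn a n γ ∈ ({0, 1} : Set ℝ)) (heq : Pn a n γ = Pn a n b) :
    Pn a k γ = Pn a k b := by
  have h := abs_sub_le_abs_sub_of_two_le_pow hpos hk hγ hb hkn hval hprim hpow hn
  rw [heq, sub_self, abs_zero] at h
  linarith [abs_eq_zero.1 (le_antisymm h (abs_nonneg _))]

/-- If the orbit in base `β` visits `{0, 1}` for the first time at `k`, not later than the orbit
in base `β'` does, then `β = β'` or both orbits visit the same
endpoint at some time before `n`. -/
lemma exists_common_visit {a : ℕ → ℤ} (hpos : ∀ n, 0 ≤ a n) {n k k' : ℕ} {β β' : ℝ}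
    (hβ : β ∈ Jn a n) (hβ' : β' ∈ Jn a n) (heq : Pn a n β = Pn a n β')
    (hn : Pn a n β ∈ ({0, 1} : Set ℝ)) (hk : 1 ≤ k) (hkk' : k ≤ k') (hk'n : k' ≤ n)
    (hval : Pn a k β ∈ ({0, 1} : Set ℝ)) (hval' : Pn a k' β' ∈ ({0, 1} : Set ℝ))
    (hprim : ∀ m, 1 ≤ m → m < k → Pn a m β ∉ ({0, 1} : Set ℝ))
    (hprim' : ∀ m, 1 ≤ m → m < k' → Pn a m β' ∉ ({0, 1} : Set ℝ)) :
    β = β' ∨ ∃ m, 1 ≤ m ∧ m < n ∧ Pn a m β = Pn a m β' ∧ Pn a m β ∈ ({0, 1} : Set ℝ) := by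
  have hpow : 2 ≤ β ^ k := two_le_pow_of_Pn (Jn_anti (hkk'.trans hk'n) hβ) hk hval
  rcases hk'n.lt_or_eq with hlt | rfl
  · have h := Pn_eq_of_two_le_pow hpos (hk.trans hkk') hβ' hβ hk'n hval' hprim'
      (hpow.trans (pow_le_pow_right₀ hβ.1.le hkk')) (heq ▸ hn) heq.symm
    exact Or.inr ⟨k', hk.trans hkk', hlt, h.symm, h ▸ hval'⟩
  · have hle : β ≤ β' := le_of_forall_Pn_notMem (hk.trans hkk') hβ' heq hval' hprim'
    rcases hkk'.lt_or_eq with hlt | rfl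
    · have hβ0 : 0 ≤ β := by linarith [hβ.1]
      have h := Pn_eq_of_two_le_pow hpos hk hβ hβ' hkk' hval hprim
        (hpow.trans (pow_le_pow_left₀ hβ0 hle k)) hn heq
      exact Or.inr ⟨k, hk, hlt, h, hval⟩
    · exact Or.inl (hle.antisymm (le_of_forall_Pn_notMem hk hβ heq.symm hval hprim))

lemma exists_first_visit {a : ℕ → ℤ} {n : ℕ} (hn : 1 ≤ n) {γ : ℝ}
    (hval : Pn a n γ ∈ ({0, 1} : Set ℝ)) :
    ∃ k, 1 ≤ k ∧ k ≤ n ∧ Pn a k γ ∈ ({0, 1} : Set ℝ) ∧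
      ∀ m, 1 ≤ m → m < k → Pn a m γ ∉ ({0, 1} : Set ℝ) := by
  classical
  have hex : ∃ k, 1 ≤ k ∧ Pn a k γ ∈ ({0, 1} : Set ℝ) := ⟨n, hn, hval⟩
  exact ⟨Nat.find hex, (Nat.find_spec hex).1, Nat.find_min' hex ⟨hn, hval⟩,
    (Nat.find_spec hex).2, fun m h1 h2 h3 => Nat.find_min hex h2 ⟨h1, h3⟩⟩

/-- Two bases in `J_n` with the same value of `P_n` in `{0, 1}` coincide; nonnegativity of the
digits is enough for this. -/
lemma eq_of_Pn_eq {a : ℕ → ℤ} (hpos : ∀ n, 0 ≤ a n) {β β' : ℝ} (n : ℕ) (hn : 1 ≤ n)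
    (hβ : β ∈ Jn a n) (hβ' : β' ∈ Jn a n) (heq : Pn a n β = Pn a n β')
    (hval : Pn a n β ∈ ({0, 1} : Set ℝ)) : β = β' := by
  induction n using Nat.strong_induction_on with
  | _ n ih =>
  obtain ⟨k, hk, hkn, hv, hprim⟩ := exists_first_visit hn hval
  obtain ⟨k', hk', hkn', hv', hprim'⟩ := exists_first_visit (γ := β') hn (heq ▸ hval)
  have hcommon :
      β = β' ∨ ∃ m, 1 ≤ m ∧ m < n ∧ Pn a m β = Pn a m β' ∧ Pn a m β ∈ ({0, 1} : Set ℝ) := by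
    rcases le_total k k' with h | h
    · exact exists_common_visit hpos hβ hβ' heq hval hk h hkn' hv hv' hprim hprim'
    · rcases exists_common_visit hpos hβ' hβ heq.symm (heq ▸ hval) hk' h hkn hv' hv hprim' hprim
        with h | ⟨m, h1, h2, h3, h4⟩
      · exact Or.inl h.symm
      · exact Or.inr ⟨m, h1, h2, h3.symm, h3 ▸ h4⟩
  rcases hcommon with h | ⟨m, h1, h2, h3, h4⟩
  · exact h
  · exact ih m h2 h1 (Jn_anti h2.le hβ) (Jn_anti h2.le hβ') h3 h4

/-- under (G) and (L), if β, β' ∈ J_n and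
P_n(β) = P_n(β') ∈ {0,1}, then β = β'. -/
theorem stmt_14 (a : ℕ → ℤ) (hpos : ∀ n, 0 ≤ a n) (hG : CondG a) (hL : CondL a)
    (n : ℕ) (hn : 1 ≤ n) (β β' : ℝ) (hβ : β ∈ Jn a n) (hβ' : β' ∈ Jn a n)
    (heq : Pn a n β = Pn a n β') (hval : Pn a n β ∈ ({0, 1} : Set ℝ)) :
    β = β' := by
  exact eq_of_Pn_eq hpos n hn hβ hβ' heq hval
end
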